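/- arXiv:1605.09733 — 2 statements merged into one kernel-verified Lean document; each statement's English description precedes it below -/
import Mathlib

section
/- The iterative Condorcet rule on n players is not 2-SNM-α for any α < 1/2 − 1/(n(n−1)). -/
abbrev Tournament (n : ℕ) := Fin n → Fin n → Bool

def IsTournament {n : ℕ} (T : Tournament n) : Prop :=
  (∀ i, T i i = false) ∧ ∀ i j : Fin n, i ≠ j → T i j = !T j i

def CondorcetWinner {n : ℕ} (T : Tournament n) (i : Fin n) : Prop :=
  ∀ j, j ≠ i → T i j = true

def PairAdjacent {n : ℕ} (i j : Fin n) (T T' : Tournament n) : Prop :=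
  ∀ a b : Fin n, ¬((a = i ∧ b = j) ∨ (a = j ∧ b = i)) → T a b = T' a b

def SAdjacent {n : ℕ} (S : Finset (Fin n)) (T T' : Tournament n) : Prop :=
  ∀ a b : Fin n, (a ∉ S ∨ b ∉ S) → T a b = T' a b

def IsRule {n : ℕ} (r : Tournament n → Fin n → ℝ) : Prop :=
  ∀ T, IsTournament T → (∀ i, 0 ≤ r T i) ∧ (∑ i, r T i) = 1

def CondorcetConsistent {n : ℕ} (r : Tournament n → Fin n → ℝ) : Prop :=
  ∀ T, IsTournament T → ∀ i, CondorcetWinner T i → r T i = 1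

def SNM2 {n : ℕ} (r : Tournament n → Fin n → ℝ) (α : ℝ) : Prop :=
  ∀ T T' : Tournament n, IsTournament T → IsTournament T' →
    ∀ i j : Fin n, i ≠ j → PairAdjacent i j T T' →
      r T' i + r T' j - r T i - r T j ≤ α

def SNMk {n : ℕ} (k : ℕ) (r : Tournament n → Fin n → ℝ) (α : ℝ) : Prop :=
  ∀ S : Finset (Fin n), S.card ≤ k → ∀ T T' : Tournament n,
    IsTournament T → IsTournament T' → SAdjacent S T T' →
      (∑ i ∈ S, r T' i) - (∑ i ∈ S, r T i) ≤ α

def flipTo {n : ℕ} (i j : Fin n) (T : Tournament n) : Tournament n :=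
  fun a b => if a = i ∧ b = j then true else if a = j ∧ b = i then false else T a b

def winCount {n : ℕ} (T : Tournament n) (i : Fin n) : ℕ :=
  (Finset.univ.filter fun j => T i j = true).card

def cyclicT (m w : ℕ) : Tournament m :=
  fun i j => decide (1 ≤ (j.val + m - i.val) % m ∧ (j.val + m - i.val) % m ≤ w)

def skT (n : ℕ) : Tournament n :=
  fun i j =>
    if i.val = n - 1 ∧ j.val = 0 then true
    else if i.val = 0 ∧ j.val = n - 1 then false
    else decide (i.val < j.val)

def survivors {n : ℕ} (π : Equiv.Perm (Fin n)) (t : ℕ) : Finset (Fin n) :=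
  Finset.univ.filter fun x => ∀ s : Fin n, s.val < t → π s ≠ x

def CondorcetIn {n : ℕ} (T : Tournament n) (S : Finset (Fin n)) (i : Fin n) : Prop :=
  i ∈ S ∧ ∀ j ∈ S, j ≠ i → T i j = true

/-- Removing players π 0, π 1, ... in order, the outcome of the iterative Condorcet
rule is the Condorcet winner of the first surviving set that has one. -/
def ICOutcome {n : ℕ} (T : Tournament n) (π : Equiv.Perm (Fin n)) (i : Fin n) : Prop :=
  ∃ t : ℕ, CondorcetIn T (survivors π t) i ∧
    ∀ s < t, ¬ ∃ w, CondorcetIn T (survivors π s) w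

open Classical in
noncomputable def icRule (n : ℕ) : Tournament n → Fin n → ℝ :=
  fun T i =>
    ((Finset.univ.filter fun π : Equiv.Perm (Fin n) => ICOutcome T π i).card : ℝ) /
      (Nat.factorial n)

theorem mem_survivors {n : ℕ} (π : Equiv.Perm (Fin n)) (t : ℕ) (x : Fin n) :
    x ∈ survivors π t ↔ t ≤ (π.symm x).val := by
  simp only [survivors, Finset.mem_filter, Finset.mem_univ, true_and]
  constructor
  · intro h
    by_contra hlt
    exact h (π.symm x) (by omega) (by simp)
  · rintro h s hs rfl
    simp only [Equiv.symm_apply_apply] at h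
    omega

theorem isTournament_skT {n : ℕ} (hn : 2 ≤ n) : IsTournament (skT n) := by
  refine ⟨fun i => ?_, fun i j hij => ?_⟩
  · simp only [skT]
    grind
  · have : i.val ≠ j.val := fun h => hij (Fin.ext h)
    simp only [skT]
    grind

/-- The transitive tournament in which players with smaller index win. -/
def transitiveT (n : ℕ) : Tournament n := fun i j => decide (i < j)

theorem isTournament_transitiveT (n : ℕ) : IsTournament (transitiveT n) := by
  refine ⟨fun i => by simp [transitiveT], fun i j hij => ?_⟩
  simp only [transitiveT]
  grind

theorem icRule_eq_one_of_condorcetWinner {n : ℕ} {T : Tournament n} {i : Fin n}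
    (h : CondorcetWinner T i) : icRule n T i = 1 := by
  classical
  have hout : ∀ π : Equiv.Perm (Fin n), ICOutcome T π i := fun π =>
    ⟨0, ⟨(mem_survivors π 0 i).2 (Nat.zero_le _), fun j _ hj => h j hj⟩,
      fun s hs => absurd hs (Nat.not_lt_zero s)⟩
  have hpos : (Nat.factorial n : ℝ) ≠ 0 := by positivity
  simp [icRule, hout, Fintype.card_perm, hpos]

theorem icRule_nonneg {n : ℕ} (T : Tournament n) (i : Fin n) : 0 ≤ icRule n T i := by
  unfold icRule
  positivity

/-- The players `a` and `b` are the last two in the elimination order. -/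
def IsLastTwo {n : ℕ} (a b : Fin n) (π : Equiv.Perm (Fin n)) : Prop :=
  ∀ m, m ≠ a → m ≠ b → π.symm m < π.symm a ∧ π.symm m < π.symm b

theorem isLastTwo_of_icOutcome {n : ℕ} {T : Tournament n} (hT : IsTournament T) {a b : Fin n}
    (hab : a ≠ b) (hb : ∀ m, m ≠ a → m ≠ b → T b m = false) {π : Equiv.Perm (Fin n)}
    (h : ICOutcome T π b) : IsLastTwo a b π := by
  obtain ⟨t, ⟨hbt, hwin⟩, hfirst⟩ := h
  simp only [mem_survivors] at hbt hwin
  have hmid : ∀ m, m ≠ a → m ≠ b → (π.symm m).val < t := by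
    intro m hma hmb
    by_contra hlt
    have := hwin m (by omega) hmb
    simp [hb m hma hmb] at this
  have hat : t ≤ (π.symm a).val := by
    by_contra hlt
    have hrest : ∀ m, m ≠ b → (π.symm m).val < t := by
      intro m hmb
      by_cases hma : m = a
      · subst hma; omega
      · exact hmid m hma hmb
    have hblt := (π.symm b).isLt
    obtain ⟨x, hx⟩ : ∃ x, (π.symm x).val = t - 1 := ⟨π ⟨t - 1, by omega⟩, by simp⟩
    have hxb : x ≠ b := by rintro rfl; omega
    have hcases : ∀ j, t - 1 ≤ (π.symm j).val → j = x ∨ j = b := by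
      intro j hj
      by_cases hjb : j = b
      · exact Or.inr hjb
      · refine Or.inl (π.symm.injective (Fin.ext ?_))
        have := hrest j hjb
        omega
    refine hfirst (t - 1) (by omega) ?_
    cases hxT : T x b with
    | true =>
      refine ⟨x, (mem_survivors _ _ _).2 hx.ge, fun j hj hjx => ?_⟩
      rcases hcases j ((mem_survivors _ _ _).1 hj) with rfl | rfl
      · exact absurd rfl hjx
      · exact hxT
    | false =>
      refine ⟨b, (mem_survivors _ _ _).2 (by omega), fun j hj hjb => ?_⟩
      rcases hcases j ((mem_survivors _ _ _).1 hj) with rfl | rfl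
      · rw [hT.2 b j hxb.symm, hxT]; rfl
      · exact absurd rfl hjb
  intro m hma hmb
  have := hmid m hma hmb
  simp only [Fin.lt_def]
  omega

theorem symm_lt_and_not_isLastTwo_of_icOutcome {n : ℕ} {T : Tournament n} {a b : Fin n}
    (hab : a ≠ b) (hTab : T a b = false) (hTba : T b a = true) {π : Equiv.Perm (Fin n)}
    (h : ICOutcome T π a) : π.symm b < π.symm a ∧ ¬ IsLastTwo a b π := by
  obtain ⟨t, ⟨hat, hwin⟩, hfirst⟩ := h
  simp only [mem_survivors] at hat hwin
  have hbt : (π.symm b).val < t := by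
    by_contra hlt
    have := hwin b (by omega) hab.symm
    simp [hTab] at this
  refine ⟨by simp only [Fin.lt_def]; omega, fun hlast => ?_⟩
  refine hfirst _ hbt ⟨b, (mem_survivors _ _ _).2 le_rfl, fun j hj hjb => ?_⟩
  by_cases hja : j = a
  · rwa [hja]
  · have := (hlast j hja hjb).2
    rw [mem_survivors] at hj
    simp only [Fin.lt_def] at this
    omega

theorem symm_eq_of_isLastTwo {n : ℕ} (hn : 2 ≤ n) {a b : Fin n} {π : Equiv.Perm (Fin n)}
    (h : IsLastTwo a b π) (hlt : π.symm a < π.symm b) :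
    π.symm a = ⟨n - 2, by omega⟩ ∧ π.symm b = ⟨n - 1, by omega⟩ := by
  have key : ∀ x : Fin n, x ≤ π.symm a ∨ x = π.symm b := by
    intro x
    by_cases hxa : π x = a
    · left; simp [← hxa]
    · by_cases hxb : π x = b
      · right; simp [← hxb]
      · left
        have := (h (π x) hxa hxb).1
        simp only [Equiv.symm_apply_apply] at this
        exact this.le
  have h1 := key ⟨n - 1, by omega⟩
  have h2 := key ⟨n - 2, by omega⟩
  simp only [Fin.le_def, Fin.lt_def, Fin.ext_iff] at *
  omega

theorem two_mul_card_symm_lt_le {n : ℕ} (a b : Fin n) :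
    2 * (Finset.univ.filter fun π : Equiv.Perm (Fin n) => π.symm b < π.symm a).card
      ≤ n.factorial := by
  have hswap : (Finset.univ.filter fun π : Equiv.Perm (Fin n) => π.symm b < π.symm a).card
      = (Finset.univ.filter fun π : Equiv.Perm (Fin n) => π.symm a < π.symm b).card := by
    refine Finset.card_equiv (Equiv.mulLeft (Equiv.swap a b)) fun π => ?_
    simp [← Equiv.Perm.inv_def, mul_inv_rev]
  have hdisj : Disjoint
      (Finset.univ.filter fun π : Equiv.Perm (Fin n) => π.symm b < π.symm a)
      (Finset.univ.filter fun π : Equiv.Perm (Fin n) => π.symm a < π.symm b) :=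
    Finset.disjoint_filter.2 fun π _ h => h.not_gt
  have hle := Finset.card_le_univ
    ((Finset.univ.filter fun π : Equiv.Perm (Fin n) => π.symm b < π.symm a) ∪
      (Finset.univ.filter fun π : Equiv.Perm (Fin n) => π.symm a < π.symm b))
  rw [Finset.card_union_of_disjoint hdisj, Fintype.card_perm, Fintype.card_fin] at hle
  omega

theorem card_symm_eq_mul {n : ℕ} {a b x y : Fin n} (hab : a ≠ b) (hxy : x ≠ y) :
    n * (n - 1) * (Finset.univ.filter fun π : Equiv.Perm (Fin n) =>
      π.symm a = x ∧ π.symm b = y).card = n.factorial := by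
  have hfib : ∀ z ∈ (Finset.univ : Finset (Fin n)).offDiag,
      (Finset.univ.filter fun π : Equiv.Perm (Fin n) => (π.symm a, π.symm b) = z).card
      = (Finset.univ.filter fun π : Equiv.Perm (Fin n) =>
          π.symm a = x ∧ π.symm b = y).card := by
    rintro ⟨u, v⟩ huv
    have huv' : u ≠ v := by simpa using huv
    obtain ⟨σ, hσx, hσy⟩ : ∃ σ : Equiv.Perm (Fin n), σ x = u ∧ σ y = v :=
      (MulAction.is_two_pretransitive_iff (G := Equiv.Perm (Fin n)) (α := Fin n)).1
        (Equiv.Perm.isMultiplyPretransitive (Fin n) 2) hxy huv'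
    refine Finset.card_equiv (Equiv.mulRight σ) fun π => ?_
    simp [Equiv.symm_apply_eq, hσx, hσy]
  have hsum := Finset.card_eq_sum_card_fiberwise
    (f := fun π : Equiv.Perm (Fin n) => (π.symm a, π.symm b))
    (s := Finset.univ) (t := (Finset.univ : Finset (Fin n)).offDiag)
    (fun π _ => by simpa using hab)
  rw [Finset.sum_congr rfl hfib, Finset.sum_const, Finset.offDiag_card, Finset.card_univ,
    Finset.card_univ, Fintype.card_perm, Fintype.card_fin, smul_eq_mul] at hsum
  rw [hsum, Nat.mul_sub_one]

theorem card_icOutcome_add_le {n : ℕ} (hn : 2 ≤ n) {T : Tournament n} (hT : IsTournament T)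
    {a b : Fin n} (hab : a ≠ b) (hTba : T b a = true)
    (hb : ∀ m, m ≠ a → m ≠ b → T b m = false) [DecidablePred fun π => ICOutcome T π a]
    [DecidablePred fun π => ICOutcome T π b] :
    (Finset.univ.filter fun π : Equiv.Perm (Fin n) => ICOutcome T π a).card
      + (Finset.univ.filter fun π : Equiv.Perm (Fin n) => ICOutcome T π b).card
    ≤ (Finset.univ.filter fun π : Equiv.Perm (Fin n) => π.symm b < π.symm a).card
      + (Finset.univ.filter fun π : Equiv.Perm (Fin n) =>
          π.symm a = ⟨n - 2, by omega⟩ ∧ π.symm b = ⟨n - 1, by omega⟩).card := by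
  have hTab : T a b = false := by rw [hT.2 a b hab, hTba]; rfl
  have hdisj : Disjoint
      (Finset.univ.filter fun π : Equiv.Perm (Fin n) => ICOutcome T π a)
      (Finset.univ.filter fun π : Equiv.Perm (Fin n) => ICOutcome T π b) :=
    Finset.disjoint_filter.2 fun π _ h h' =>
      (symm_lt_and_not_isLastTwo_of_icOutcome hab hTab hTba h).2
        (isLastTwo_of_icOutcome hT hab hb h')
  rw [← Finset.card_union_of_disjoint hdisj]
  refine (Finset.card_le_card fun π hπ => ?_).trans (Finset.card_union_le _ _)
  simp only [Finset.mem_union, Finset.mem_filter, Finset.mem_univ, true_and] at hπ ⊢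
  rcases hπ with h | h
  · exact Or.inl (symm_lt_and_not_isLastTwo_of_icOutcome hab hTab hTba h).1
  · rcases lt_or_gt_of_ne (π.symm.injective.ne hab) with hlt | hlt
    · exact Or.inr (symm_eq_of_isLastTwo hn (isLastTwo_of_icOutcome hT hab hb h) hlt)
    · exact Or.inl hlt

theorem icRule_add_icRule_le {n : ℕ} (hn : 2 ≤ n) {T : Tournament n} (hT : IsTournament T)
    {a b : Fin n} (hab : a ≠ b) (hTba : T b a = true)
    (hb : ∀ m, m ≠ a → m ≠ b → T b m = false) :
    icRule n T a + icRule n T b ≤ 1 / 2 + 1 / ((n : ℝ) * ((n : ℝ) - 1)) := by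
  classical
  have h1 := card_icOutcome_add_le hn hT hab hTba hb
  have h2 := two_mul_card_symm_lt_le a b
  have h3 := card_symm_eq_mul (x := ⟨n - 2, by omega⟩) (y := ⟨n - 1, by omega⟩) hab
    (by simp only [ne_eq, Fin.mk.injEq]; omega)
  have hpos : (0 : ℝ) < n.factorial := by positivity
  have hn' : (2 : ℝ) ≤ n := by exact_mod_cast hn
  have hnn : (0 : ℝ) < (n : ℝ) * ((n : ℝ) - 1) := mul_pos (by linarith) (by linarith)
  unfold icRule
  rw [← add_div, div_le_iff₀ hpos]
  rify at h1 h2 h3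
  rw [Nat.cast_sub (by omega), Nat.cast_one, mul_comm, ← eq_div_iff hnn.ne'] at h3
  rw [h3] at h1
  convert h1.trans (add_le_add_left (show _ ≤ (n.factorial : ℝ) / 2 by linarith) _) using 1
  ring

/-- The iterative Condorcet rule on n players is not 2-SNM-α for α < 1/2 - 1/(n(n-1)). -/
theorem stmt_9 (n : ℕ) (hn : 3 ≤ n) (α : ℝ) (hsnm : SNM2 (icRule n) α) :
    1/2 - 1/((n:ℝ) * ((n:ℝ) - 1)) ≤ α := by
  set a : Fin n := ⟨0, by omega⟩ with ha
  set b : Fin n := ⟨n - 1, by omega⟩ with hb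
  have hab : a ≠ b := by simp only [ha, hb, ne_eq, Fin.mk.injEq]; omega
  have hT := isTournament_skT (n := n) (by omega)
  have hadj : PairAdjacent a b (skT n) (transitiveT n) := by
    intro i j hij
    simp only [ha, hb, Fin.ext_iff] at hij
    simp only [skT, transitiveT, Fin.lt_def]
    grind
  have hsk : icRule n (skT n) a + icRule n (skT n) b
      ≤ 1 / 2 + 1 / ((n : ℝ) * ((n : ℝ) - 1)) := by
    refine icRule_add_icRule_le (by omega) hT hab (by simp [skT, ha, hb]) fun m hma hmb => ?_
    have := m.isLt
    simp only [ha, ne_eq, Fin.ext_iff] at hma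
    simp only [skT, hb]
    grind
  have hone : icRule n (transitiveT n) a = 1 := by
    refine icRule_eq_one_of_condorcetWinner fun j hj => ?_
    simp only [ha, ne_eq, Fin.ext_iff] at hj
    simp only [transitiveT, ha, Fin.lt_def, decide_eq_true_eq]
    omega
  have hnonneg := icRule_nonneg (transitiveT n) b
  have := hsnm _ _ hT (isTournament_transitiveT n) a b hab hadj
  linarith
end

section
/- The random single-elimination bracket rule on n = 2^h players is 2-SNM-1/3: for any tournament T where j beats i, and T' the {i,j}-adjacent tournament where i beats j, the probability over a uniformly random bracket that the winner is in {i,j} increases by at most 1/3 when switching from T to T'. -/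
def leftHalf {α : Type*} (h : ℕ) (f : Fin (2^(h+1)) → α) : Fin (2^h) → α :=
  fun x => f ⟨x.val, by
    have hx := x.isLt
    have h2 : (2:ℕ)^(h+1) = 2^h + 2^h := by rw [pow_succ]; omega
    omega⟩

def rightHalf {α : Type*} (h : ℕ) (f : Fin (2^(h+1)) → α) : Fin (2^h) → α :=
  fun x => f ⟨2^h + x.val, by
    have hx := x.isLt
    have h2 : (2:ℕ)^(h+1) = 2^h + 2^h := by rw [pow_succ]; omega
    omega⟩

def bWinner {n : ℕ} (T : Tournament n) : (h : ℕ) → (Fin (2^h) → Fin n) → Fin n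
  | 0, f => f ⟨0, by norm_num⟩
  | h+1, f =>
      let a := bWinner T h (leftHalf h f)
      let b := bWinner T h (rightHalf h f)
      if T a b then a else b

def bMeets {n : ℕ} (T : Tournament n) (i j : Fin n) : (h : ℕ) → (Fin (2^h) → Fin n) → Prop
  | 0, _ => False
  | h+1, f =>
      (bWinner T h (leftHalf h f) = i ∧ bWinner T h (rightHalf h f) = j) ∨
      (bWinner T h (leftHalf h f) = j ∧ bWinner T h (rightHalf h f) = i) ∨
      bMeets T i j h (leftHalf h f) ∨ bMeets T i j h (rightHalf h f)

noncomputable def rseb (h : ℕ) : Tournament (2^h) → Fin (2^h) → ℝ :=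
  fun T i =>
    ((Finset.univ.filter fun B : Equiv.Perm (Fin (2^h)) =>
      bWinner T h (fun x => B x) = i).card : ℝ) / (Nat.factorial (2^h))

/-- The winner of the block of positions `[r * 2 ^ s, (r + 1) * 2 ^ s)` of the bracket `F`. -/
def blockWinner (T : ℕ → ℕ → Bool) (F : ℕ → ℕ) : ℕ → ℕ → ℕ
  | 0, r => F r
  | s + 1, r =>
      if T (blockWinner T F s (2 * r)) (blockWinner T F s (2 * r + 1)) then
        blockWinner T F s (2 * r)
      else blockWinner T F s (2 * r + 1)

/-- The block facing the block `r` in the next round. -/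
def sibling (r : ℕ) : ℕ := r + 1 - 2 * (r % 2)

theorem sibling_ne (r : ℕ) : sibling r ≠ r := by unfold sibling; omega

theorem sibling_sibling (r : ℕ) : sibling (sibling r) = r := by unfold sibling; omega

theorem sibling_div_two (r : ℕ) : sibling r / 2 = r / 2 := by unfold sibling; omega

theorem div_two_pow_succ (x s : ℕ) : x / 2 ^ (s + 1) = x / 2 ^ s / 2 := by
  rw [Nat.div_div_eq_div_mul, pow_succ]

theorem div_two_pow_eq_of_le {x y s t : ℕ} (hst : s ≤ t) (h : x / 2 ^ s = y / 2 ^ s) :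
    x / 2 ^ t = y / 2 ^ t := by
  obtain ⟨d, rfl⟩ := Nat.exists_eq_add_of_le hst
  rw [pow_add, ← Nat.div_div_eq_div_mul, h, Nat.div_div_eq_div_mul]

section BlockWinner

variable {T T' : ℕ → ℕ → Bool} {F : Equiv.Perm ℕ}

theorem exists_blockWinner_add (T : ℕ → ℕ → Bool) (F : ℕ → ℕ) (t d r : ℕ) :
    ∃ r', blockWinner T F (t + d) r = blockWinner T F t r' ∧ r' / 2 ^ d = r := by
  induction d generalizing r with
  | zero => exact ⟨r, rfl, by simp⟩
  | succ d ih =>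
    rw [← add_assoc, blockWinner]
    split_ifs
    · obtain ⟨r', h, hr⟩ := ih (2 * r)
      exact ⟨r', h, by rw [div_two_pow_succ, hr]; omega⟩
    · obtain ⟨r', h, hr⟩ := ih (2 * r + 1)
      exact ⟨r', h, by rw [div_two_pow_succ, hr]; omega⟩

theorem symm_blockWinner_div (T : ℕ → ℕ → Bool) (F : Equiv.Perm ℕ) (s r : ℕ) :
    F.symm (blockWinner T F s r) / 2 ^ s = r := by
  obtain ⟨r', h, hr⟩ := exists_blockWinner_add T F 0 s r
  rw [zero_add] at h
  rw [h, blockWinner, Equiv.symm_apply_apply, hr]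

theorem eq_div_of_blockWinner_eq {s r a : ℕ} (h : blockWinner T F s r = a) :
    r = F.symm a / 2 ^ s := by
  rw [← h, symm_blockWinner_div]

theorem blockWinner_injective (T : ℕ → ℕ → Bool) (F : Equiv.Perm ℕ) (s : ℕ) :
    Function.Injective (blockWinner T F s) :=
  fun _ _ h => (eq_div_of_blockWinner_eq h).trans (symm_blockWinner_div T F s _)

theorem blockWinner_of_le {s t r a : ℕ} (h : blockWinner T F s r = a) (hts : t ≤ s) :
    blockWinner T F t (F.symm a / 2 ^ t) = a := by
  obtain ⟨d, rfl⟩ := Nat.exists_eq_add_of_le hts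
  obtain ⟨r', h', -⟩ := exists_blockWinner_add T F t d r
  rw [h] at h'
  rw [← eq_div_of_blockWinner_eq h'.symm, h']

theorem blockWinner_succ_half (hT : ∀ a b, a ≠ b → T a b = !T b a) (s r : ℕ) :
    blockWinner T F (s + 1) (r / 2) =
      if T (blockWinner T F s r) (blockWinner T F s (sibling r)) then blockWinner T F s r
      else blockWinner T F s (sibling r) := by
  have hne : blockWinner T F s r ≠ blockWinner T F s (sibling r) :=
    fun h => sibling_ne r (blockWinner_injective T F s h).symm
  have hanti := hT _ _ hne
  rw [blockWinner]
  rcases Nat.mod_two_eq_zero_or_one r with hr | hr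
  · have h1 : 2 * (r / 2) = r := by omega
    have h2 : sibling r = r + 1 := by unfold sibling; omega
    rw [h1, h2]
  · have h1 : 2 * (r / 2) = sibling r := by unfold sibling; omega
    have h2 : sibling r + 1 = r := by unfold sibling; omega
    rw [h1, h2, hanti]
    cases T (blockWinner T F s (sibling r)) (blockWinner T F s r) <;> simp

theorem blockWinner_congr {F G : ℕ → ℕ} (s r r' : ℕ)
    (h : ∀ y < 2 ^ s, F (r * 2 ^ s + y) = G (r' * 2 ^ s + y)) :
    blockWinner T F s r = blockWinner T G s r' := by
  induction s generalizing r r' with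
  | zero => simpa [blockWinner] using h 0
  | succ s ih =>
    have hl : blockWinner T F s (2 * r) = blockWinner T G s (2 * r') := by
      refine ih _ _ fun y hy => ?_
      have := h y (by rw [pow_succ]; omega)
      convert this using 2 <;> ring
    have hr : blockWinner T F s (2 * r + 1) = blockWinner T G s (2 * r' + 1) := by
      refine ih _ _ fun y hy => ?_
      have := h (2 ^ s + y) (by rw [pow_succ]; omega)
      convert this using 2 <;> ring
    rw [blockWinner, blockWinner, hl, hr]

theorem blockWinner_eq_of_agree {c : ℕ} (h : ∀ a b, a ≠ c → b ≠ c → T' a b = T a b) (s r : ℕ)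
    (hr : F.symm c / 2 ^ s ≠ r) : blockWinner T' F s r = blockWinner T F s r := by
  induction s generalizing r with
  | zero => rfl
  | succ s ih =>
    rw [div_two_pow_succ] at hr
    have hne : ∀ r', r' / 2 = r → F.symm c / 2 ^ s ≠ r' := by
      rintro r' h' rfl
      exact hr h'
    have h0 := hne (2 * r) (by omega)
    have h1 := hne (2 * r + 1) (by omega)
    rw [blockWinner, blockWinner, ih _ h0, ih _ h1, h]
    · exact fun e => h0 (eq_div_of_blockWinner_eq e).symm
    · exact fun e => h1 (eq_div_of_blockWinner_eq e).symm

/-- Exchange the blocks `p` and `q` of length `2 ^ t`. -/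
def blockSwap (t p q : ℕ) : Equiv.Perm ℕ :=
  Function.Involutive.toPerm (fun x => Equiv.swap p q (x / 2 ^ t) * 2 ^ t + x % 2 ^ t) (by
    intro x
    have h1 : (Equiv.swap p q (x / 2 ^ t) * 2 ^ t + x % 2 ^ t) / 2 ^ t =
        Equiv.swap p q (x / 2 ^ t) := by
      rw [mul_comm, Nat.mul_add_div (by positivity), Nat.div_eq_of_lt (Nat.mod_lt _ (by positivity)),
        add_zero]
    simp only [h1, Equiv.swap_apply_self, Nat.mul_add_mod_self_right, Nat.mod_mod]
    exact Nat.div_add_mod' x _)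

theorem blockSwap_apply (t p q x : ℕ) :
    blockSwap t p q x = Equiv.swap p q (x / 2 ^ t) * 2 ^ t + x % 2 ^ t := rfl

theorem blockSwap_trans_blockSwap (t p q : ℕ) (F : Equiv.Perm ℕ) :
    (blockSwap t p q).trans ((blockSwap t p q).trans F) = F := by
  ext x
  exact congrArg F (Function.Involutive.toPerm_involutive _ x)

theorem blockWinner_blockSwap (T : ℕ → ℕ → Bool) (F : Equiv.Perm ℕ) (t p q r : ℕ) :
    blockWinner T ((blockSwap t p q).trans F) t r = blockWinner T F t (Equiv.swap p q r) := by
  refine blockWinner_congr _ _ _ fun y hy => ?_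
  rw [Equiv.trans_apply, blockSwap_apply, mul_comm r, Nat.mul_add_div (by positivity),
    Nat.div_eq_of_lt hy, Nat.mul_add_mod, Nat.mod_eq_of_lt hy, add_zero]

theorem exists_blockWinner_loss {h a : ℕ} (s : ℕ) (hsh : s ≤ h)
    (hs : blockWinner T F s (F.symm a / 2 ^ s) = a)
    (hh : blockWinner T F h (F.symm a / 2 ^ h) ≠ a) :
    ∃ u, s ≤ u ∧ u < h ∧ blockWinner T F u (F.symm a / 2 ^ u) = a ∧
      blockWinner T F (u + 1) (F.symm a / 2 ^ (u + 1)) ≠ a := by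
  by_contra! hcon
  refine hh ?_
  induction h, hsh using Nat.le_induction with
  | base => exact hs
  | succ k hk ih =>
    have : blockWinner T F k (F.symm a / 2 ^ k) = a := by
      by_contra hne
      exact hne (ih hne fun u h1 h2 => hcon u h1 (by omega))
    exact hcon k hk (by omega) this

/-- In the bracket `F`, player `i` wins the block `p` of length `2 ^ t` and player `j` wins the
block facing it. -/
def MeetsAt (T : ℕ → ℕ → Bool) (F : ℕ → ℕ) (i j t p : ℕ) : Prop :=
  blockWinner T F t p = i ∧ blockWinner T F t (sibling p) = j

theorem loss_of_ne (hT : ∀ a b, a ≠ b → T a b = !T b a) {s r a : ℕ}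
    (h : blockWinner T F s r = a) (h' : blockWinner T F (s + 1) (r / 2) ≠ a) :
    T (blockWinner T F s (sibling r)) a = true := by
  rw [blockWinner_succ_half hT, h] at h'
  have hne : blockWinner T F s (sibling r) ≠ a := by
    rw [← h]
    exact fun e => sibling_ne r (blockWinner_injective T F s e)
  rw [hT _ _ hne]
  by_contra hc
  simp_all

theorem win_of_eq (hT : ∀ a b, a ≠ b → T a b = !T b a) {s r a : ℕ}
    (h : blockWinner T F s r = a) (h' : blockWinner T F (s + 1) (r / 2) = a) :
    T a (blockWinner T F s (sibling r)) = true := by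
  rw [blockWinner_succ_half hT, h] at h'
  have hne : blockWinner T F s (sibling r) ≠ a := by
    rw [← h]
    exact fun e => sibling_ne r (blockWinner_injective T F s e)
  by_contra hc
  simp_all

section Throw

variable {i j : ℕ} (hT : ∀ a b, a ≠ b → T a b = !T b a) (hT' : ∀ a b, a ≠ b → T' a b = !T' b a)
  (hagree : ∀ a b, ¬((a = i ∧ b = j) ∨ (a = j ∧ b = i)) → T' a b = T a b)
  (hji : T j i = true) (hij : T' i j = true) (hne : i ≠ j)

include hT hT' hagree hij hne in
theorem blockWinner_eq_of_thrower_wins {h r : ℕ} (hw : blockWinner T' F h r = j) :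
    blockWinner T F h r = j := by
  have hr := eq_div_of_blockWinner_eq hw
  by_contra hc
  rw [hr] at hc
  obtain ⟨u, -, hu, h1, h2⟩ := exists_blockWinner_loss (T := T) (F := F) 0 (Nat.zero_le h)
    (by simp [blockWinner]) hc
  rw [div_two_pow_succ] at h2
  have hloss := loss_of_ne hT h1 h2
  have h3 := blockWinner_of_le hw hu.le
  have h4 := blockWinner_of_le hw (Nat.succ_le_of_lt hu)
  rw [Nat.succ_eq_add_one, div_two_pow_succ] at h4
  have hwin := win_of_eq hT' h3 h4
  rw [blockWinner_eq_of_agree (T := T) (c := j) (fun a b ha hb => hagree a b (by tauto)) _ _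
    (sibling_ne _).symm] at hwin
  set k := blockWinner T F u (sibling (F.symm j / 2 ^ u)) with hk
  have hkj : k ≠ j := fun e => sibling_ne _ (eq_div_of_blockWinner_eq e)
  have hki : k ≠ i := by
    intro e
    rw [e, hT' _ _ hne.symm, hij] at hwin
    simp at hwin
  rw [hagree _ _ (by tauto), hT _ _ hkj.symm, hloss] at hwin
  simp at hwin

include hT hT' hagree hji hij hne in
theorem exists_meetsAt {h : ℕ} (hw : blockWinner T' F h 0 = i ∨ blockWinner T' F h 0 = j)
    (hwi : blockWinner T F h 0 ≠ i) (hwj : blockWinner T F h 0 ≠ j) :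
    ∃ t p q, t < h ∧ MeetsAt T F i j t p ∧ q ≠ p ∧ q ≠ sibling p ∧
      T (blockWinner T F t q) j = true ∧ T i (blockWinner T F t q) = true := by
  have hw' : blockWinner T' F h 0 = i := hw.resolve_right fun e =>
    hwj (blockWinner_eq_of_thrower_wins hT hT' hagree hij hne e)
  have hposi := eq_div_of_blockWinner_eq hw'
  rw [hposi] at hwi
  obtain ⟨t, -, hth, h1, h2⟩ := exists_blockWinner_loss (T := T) (F := F) 0 (Nat.zero_le h)
    (by simp [blockWinner]) hwi
  rw [div_two_pow_succ] at h2
  have hwin : ∀ s < h,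
      T' i (blockWinner T F s (sibling (F.symm i / 2 ^ s))) = true := by
    intro s hs
    have h4 := blockWinner_of_le hw' (Nat.succ_le_of_lt hs)
    rw [Nat.succ_eq_add_one, div_two_pow_succ] at h4
    have := win_of_eq hT' (blockWinner_of_le hw' hs.le) h4
    rwa [blockWinner_eq_of_agree (T := T) (c := i) (fun a b ha hb => hagree a b (by tauto)) _ _
      (sibling_ne _).symm] at this
  have hloss := loss_of_ne hT h1 h2
  set p := F.symm i / 2 ^ t with hp
  have hmj : blockWinner T F t (sibling p) = j := by
    by_contra hc
    have hx := hwin t hth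
    have hki : blockWinner T F t (sibling p) ≠ i :=
      fun e => sibling_ne _ (eq_div_of_blockWinner_eq e)
    rw [← hp, hagree _ _ (by tauto), hT _ _ hki.symm, hloss] at hx
    simp at hx
  have hposj := eq_div_of_blockWinner_eq hmj
  have hsame : ∀ s, t + 1 ≤ s → F.symm j / 2 ^ s = F.symm i / 2 ^ s := fun s hs => by
    refine div_two_pow_eq_of_le hs ?_
    rw [div_two_pow_succ, div_two_pow_succ, ← hposj, ← hp, sibling_div_two]
  have h5 : blockWinner T F (t + 1) (F.symm j / 2 ^ (t + 1)) = j := by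
    rw [hsame _ le_rfl, div_two_pow_succ, ← hp, blockWinner_succ_half hT, h1, hmj,
      hT _ _ hne, hji]
    simp
  have h6 : blockWinner T F h (F.symm j / 2 ^ h) ≠ j := by
    rwa [hsame h (by omega), ← hposi]
  obtain ⟨u, htu, huh, h7, h8⟩ := exists_blockWinner_loss (t + 1) (by omega) h5 h6
  rw [div_two_pow_succ] at h8
  have hk := loss_of_ne hT h7 h8
  have hik := hwin u huh
  rw [hsame u htu] at hk
  obtain ⟨d, rfl⟩ := Nat.exists_eq_add_of_le (show t ≤ u by omega)
  obtain ⟨q, hq, hqd⟩ := exists_blockWinner_add T F t d (sibling (F.symm i / 2 ^ (t + d)))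
  have hqi : q ≠ p := by
    rintro rfl
    rw [h1] at hq
    exact sibling_ne _ (eq_div_of_blockWinner_eq hq)
  have hqj : q ≠ sibling p := by
    rintro rfl
    rw [hmj] at hq
    have := eq_div_of_blockWinner_eq hq
    rw [hsame _ htu] at this
    exact sibling_ne _ this
  rw [hq] at hk hik
  refine ⟨t, p, q, hth, ⟨h1, hmj⟩, hqi, hqj, hk, ?_⟩
  rwa [hagree] at hik
  rintro (⟨-, e⟩ | ⟨e, -⟩)
  · exact hqj (blockWinner_injective T F t (e.trans hmj.symm))
  · exact hne e

end Throw

/-- `G` arises from a bracket `F` where `i` and `j` meet by exchanging the block of `i` with an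
equally long block whose winner `k` beats `j`, or, when `k` is the only winner of such a block
to beat `j`, and `i` beats `k`, by exchanging the block of `j` with that of `k`. -/
def IsExchange (T : ℕ → ℕ → Bool) (h i j : ℕ) (F G : Equiv.Perm ℕ) : Prop :=
  ∃ t p q, t < h ∧ MeetsAt T F i j t p ∧ q ≠ p ∧ q ≠ sibling p ∧
    T (blockWinner T F t q) j = true ∧
    (G = (blockSwap t p q).trans F ∨
      (T i (blockWinner T F t q) = true ∧ (∀ r, T (blockWinner T F t r) j = true → r = q) ∧
        G = (blockSwap t (sibling p) q).trans F))

section Exchange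

variable {i j t p q : ℕ} (hT : ∀ a b, a ≠ b → T a b = !T b a)

theorem swap_winner_left (hm : MeetsAt T F i j t p) (hq : q ≠ sibling p) :
    blockWinner T ((blockSwap t p q).trans F) t q = i ∧
    blockWinner T ((blockSwap t p q).trans F) t p = blockWinner T F t q ∧
    blockWinner T ((blockSwap t p q).trans F) t (sibling p) = j := by
  simp only [blockWinner_blockSwap, Equiv.swap_apply_left, Equiv.swap_apply_right,
    Equiv.swap_apply_of_ne_of_ne (sibling_ne p) hq.symm]
  exact ⟨hm.1, trivial, hm.2⟩

theorem swap_winner_right (hm : MeetsAt T F i j t p) (hq : q ≠ p) :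
    blockWinner T ((blockSwap t (sibling p) q).trans F) t q = j ∧
    blockWinner T ((blockSwap t (sibling p) q).trans F) t (sibling p) = blockWinner T F t q ∧
    blockWinner T ((blockSwap t (sibling p) q).trans F) t p = i := by
  simp only [blockWinner_blockSwap, Equiv.swap_apply_left, Equiv.swap_apply_right,
    Equiv.swap_apply_of_ne_of_ne (sibling_ne p).symm hq.symm]
  exact ⟨hm.2, trivial, hm.1⟩

include hT in
theorem swap_left_loss (hm : MeetsAt T F i j t p) (hq : q ≠ sibling p)
    (hk : T (blockWinner T F t q) j = true) {s r : ℕ} (hts : t < s) :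
    blockWinner T ((blockSwap t p q).trans F) s r ≠ j := by
  intro hs
  obtain ⟨-, h2, h3⟩ := swap_winner_left hm hq
  have h4 := blockWinner_of_le hs (Nat.succ_le_of_lt hts)
  rw [Nat.succ_eq_add_one, div_two_pow_succ, ← eq_div_of_blockWinner_eq h3, sibling_div_two,
    blockWinner_succ_half hT, h2, h3, hk, if_pos rfl, ← hm.2] at h4
  exact hq (blockWinner_injective T F t h4)

include hT in
theorem swap_left_not_meetsAt (hji : T j i = true) (hne : i ≠ j) (hm : MeetsAt T F i j t p)
    (hqp : q ≠ p) (hq : q ≠ sibling p) (hk : T (blockWinner T F t q) j = true) (s r : ℕ) :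
    ¬ MeetsAt T ((blockSwap t p q).trans F) i j s r := by
  rintro ⟨hi, hj⟩
  obtain ⟨h1, -, h3⟩ := swap_winner_left hm hq
  rcases lt_trichotomy s t with hst | rfl | hst
  · have h4 := blockWinner_of_le h1 (Nat.succ_le_of_lt hst)
    rw [Nat.succ_eq_add_one, div_two_pow_succ, ← eq_div_of_blockWinner_eq hi,
      blockWinner_succ_half hT, hi, hj, hT _ _ hne, hji] at h4
    exact hne (by simpa using h4.symm)
  · have e1 := blockWinner_injective _ _ _ (hi.trans h1.symm)
    have e2 := blockWinner_injective _ _ _ (hj.trans h3.symm)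
    apply hqp
    rw [← e1, ← sibling_sibling r, e2, sibling_sibling]
  · exact swap_left_loss hT hm hq hk hst hj

include hT in
theorem swap_right_win (hm : MeetsAt T F i j t p) (hqp : q ≠ p)
    (hik : T i (blockWinner T F t q) = true)
    (hu : ∀ r, T (blockWinner T F t r) j = true → r = q) {s : ℕ} (hts : t ≤ s) :
    blockWinner T ((blockSwap t (sibling p) q).trans F) s
      (((blockSwap t (sibling p) q).trans F).symm j / 2 ^ s) = j := by
  obtain ⟨h1, h2, h3⟩ := swap_winner_right hm hqp
  have hu' : ∀ r, T (blockWinner T ((blockSwap t (sibling p) q).trans F) t r) j = true →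
      r = sibling p := by
    intro r hr
    rw [blockWinner_blockSwap] at hr
    have := hu _ hr
    rwa [Equiv.swap_apply_eq_iff, Equiv.swap_apply_right] at this
  generalize (blockSwap t (sibling p) q).trans F = G at *
  by_contra hc
  obtain ⟨u, htu, -, h4, h5⟩ := exists_blockWinner_loss t hts
    (by rw [← eq_div_of_blockWinner_eq h1, h1]) hc
  rw [div_two_pow_succ] at h5
  have hloss := loss_of_ne hT h4 h5
  obtain ⟨d, rfl⟩ := Nat.exists_eq_add_of_le htu
  obtain ⟨r, hr, hrd⟩ := exists_blockWinner_add T G t d (sibling (G.symm j / 2 ^ (t + d)))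
  rw [hr] at hloss
  obtain rfl := hu' r hloss
  rcases Nat.eq_zero_or_pos d with rfl | hd
  · rw [pow_zero, Nat.div_one, add_zero, ← eq_div_of_blockWinner_eq h1] at hrd
    apply hqp
    rw [← sibling_sibling q, ← hrd, sibling_sibling]
  · have h6 := blockWinner_of_le hr (show t + 1 ≤ t + d by omega)
    rw [div_two_pow_succ, symm_blockWinner_div, sibling_div_two, blockWinner_succ_half hT,
      h3, h2, if_pos hik] at h6
    exact sibling_ne p (blockWinner_injective T G t (by rw [h3, h2, h6]))

theorem swap_right_level_le (hm : MeetsAt T F i j t p) (hqp : q ≠ p)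
    (hu : ∀ r, T (blockWinner T F t r) j = true → r = q) {F' : Equiv.Perm ℕ} {t' p' q' : ℕ}
    (hm' : MeetsAt T F' i j t' p') (hqp' : q' ≠ p')
    (hk' : T (blockWinner T F' t' q') j = true)
    (he : (blockSwap t (sibling p) q).trans F = (blockSwap t' (sibling p') q').trans F') :
    t' ≤ t := by
  by_contra! hlt
  obtain ⟨h1, h2, h3⟩ := swap_winner_right hm hqp
  obtain ⟨h1', h2', h3'⟩ := swap_winner_right hm' hqp'
  have hu' : ∀ r, T (blockWinner T ((blockSwap t (sibling p) q).trans F) t r) j = true →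
      r = sibling p := by
    intro r hr
    rw [blockWinner_blockSwap] at hr
    have := hu _ hr
    rwa [Equiv.swap_apply_eq_iff, Equiv.swap_apply_right] at this
  rw [← he] at h1' h2' h3'
  generalize (blockSwap t (sibling p) q).trans F = G at *
  generalize blockWinner T F' t' q' = k' at *
  have h4 := blockWinner_of_le h2' hlt.le
  have h5 : G.symm k' / 2 ^ t = sibling p := hu' _ (by rw [h4, hk'])
  have h6 : G.symm k' / 2 ^ t' = G.symm i / 2 ^ t' := by
    refine div_two_pow_eq_of_le (Nat.succ_le_of_lt hlt) ?_
    rw [Nat.succ_eq_add_one, div_two_pow_succ, h5, sibling_div_two, div_two_pow_succ,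
      ← eq_div_of_blockWinner_eq h3]
  rw [← eq_div_of_blockWinner_eq h2', ← eq_div_of_blockWinner_eq h3'] at h6
  exact sibling_ne _ h6

include hT in
theorem isExchange_left_unique {h : ℕ} {F' G : Equiv.Perm ℕ} (h1 : IsExchange T h i j F G)
    (h2 : IsExchange T h i j F' G) : F = F' := by
  obtain ⟨t, p, q, hth, hm, hqp, hq, hk, hG⟩ := h1
  obtain ⟨t', p', q', hth', hm', hqp', hq', hk', hG'⟩ := h2
  rcases hG with rfl | ⟨hik, hu, rfl⟩ <;> rcases hG' with he | ⟨hik', hu', he⟩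
  · obtain ⟨e1, -, e3⟩ := swap_winner_left hm hq
    obtain ⟨e1', -, e3'⟩ := swap_winner_left hm' hq'
    have htt : t = t' := by
      apply le_antisymm
      · by_contra! hlt
        exact swap_left_loss hT hm' hq' hk' hlt (he ▸ e3)
      · by_contra! hlt
        exact swap_left_loss hT hm hq hk hlt (he ▸ e3')
    subst htt
    rw [← he] at e1' e3'
    have hqq := blockWinner_injective _ _ _ (e1.trans e1'.symm)
    have hpp : p = p' := by
      rw [← sibling_sibling p, blockWinner_injective _ _ _ (e3.trans e3'.symm), sibling_sibling]
    subst hqq hpp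
    rw [← blockSwap_trans_blockSwap t p q F, he, blockSwap_trans_blockSwap]
  · have := swap_right_win hT hm' hqp' hik' hu' hth'.le
    rw [← he] at this
    exact absurd this (swap_left_loss hT hm hq hk hth)
  · have := swap_right_win hT hm hqp hik hu hth.le
    rw [he] at this
    exact absurd this (swap_left_loss hT hm' hq' hk' hth')
  · obtain rfl : t = t' := le_antisymm (swap_right_level_le hm' hqp' hu' hm hqp hk he.symm)
      (swap_right_level_le hm hqp hu hm' hqp' hk' he)
    obtain ⟨e1, -, e3⟩ := swap_winner_right hm hqp
    obtain ⟨e1', -, e3'⟩ := swap_winner_right hm' hqp'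
    rw [← he] at e1' e3'
    have hqq := blockWinner_injective _ _ _ (e1.trans e1'.symm)
    have hpp := blockWinner_injective _ _ _ (e3.trans e3'.symm)
    subst hqq hpp
    rw [← blockSwap_trans_blockSwap t (sibling p) q F, he, blockSwap_trans_blockSwap]

end Exchange

end BlockWinner

section Range

variable {h : ℕ} {T T' : ℕ → ℕ → Bool} {F : Equiv.Perm ℕ} {t : ℕ}

theorem symm_lt_of_fixes {n x : ℕ} (hF : ∀ x, n ≤ x → F x = x) (hx : x < n) :
    F.symm x < n := by
  by_contra! hc
  have := hF _ hc
  rw [Equiv.apply_symm_apply] at this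
  omega

theorem blockWinner_lt_imp (hF : ∀ x, 2 ^ h ≤ x → F x = x) (hth : t ≤ h) {r : ℕ}
    (hr : blockWinner T F t r < 2 ^ h) : r < 2 ^ (h - t) := by
  rw [eq_div_of_blockWinner_eq (rfl : blockWinner T F t r = _),
    Nat.div_lt_iff_lt_mul (by positivity), ← pow_add, Nat.sub_add_cancel hth]
  exact symm_lt_of_fixes hF hr

theorem blockSwap_trans_fixes (hF : ∀ x, 2 ^ h ≤ x → F x = x) (hth : t ≤ h) {p q : ℕ}
    (hp : p < 2 ^ (h - t)) (hq : q < 2 ^ (h - t)) (x : ℕ) (hx : 2 ^ h ≤ x) :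
    (blockSwap t p q).trans F x = x := by
  have h1 : 2 ^ (h - t) ≤ x / 2 ^ t := by
    rwa [Nat.le_div_iff_mul_le (by positivity), ← pow_add, Nat.sub_add_cancel hth]
  rw [Equiv.trans_apply, blockSwap_apply, Equiv.swap_apply_of_ne_of_ne (by omega) (by omega),
    Nat.div_add_mod', hF x hx]

/-- Player `i` or `j` wins the bracket `F` under `T'`, but neither does under `T`. -/
def IsGain (T T' : ℕ → ℕ → Bool) (h i j : ℕ) (F : ℕ → ℕ) : Prop :=
  (blockWinner T' F h 0 = i ∨ blockWinner T' F h 0 = j) ∧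
    blockWinner T F h 0 ≠ i ∧ blockWinner T F h 0 ≠ j

variable {i j : ℕ} (hT : ∀ a b, a ≠ b → T a b = !T b a) (hT' : ∀ a b, a ≠ b → T' a b = !T' b a)
  (hagree : ∀ a b, ¬((a = i ∧ b = j) ∨ (a = j ∧ b = i)) → T' a b = T a b)
  (hji : T j i = true) (hij : T' i j = true) (hne : i ≠ j)

include hT hT' hagree hji hij hne in
theorem not_isGain_of_isExchange {G : Equiv.Perm ℕ} (hG : ∀ x, 2 ^ h ≤ x → G x = x)
    (hj : j < 2 ^ h) (he : IsExchange T h i j F G) :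
    ¬ IsGain T T' h i j G := by
  rintro ⟨hw, hwi, hwj⟩
  obtain ⟨t, p, q, hth, hm, hqp, hq, hk, rfl | ⟨hik, hu, rfl⟩⟩ := he
  · obtain ⟨t', p', -, -, hm', -⟩ := exists_meetsAt hT hT' hagree hji hij hne hw hwi hwj
    exact swap_left_not_meetsAt hT hji hne hm hqp hq hk t' p' hm'
  · refine hwj ?_
    have hwin := swap_right_win hT hm hqp hik hu hth.le
    rwa [Nat.div_eq_of_lt (symm_lt_of_fixes hG hj)] at hwin

include hT hT' hagree hji hij hne in
theorem exists_two_isExchange (hF : ∀ x, 2 ^ h ≤ x → F x = x) (hi : i < 2 ^ h) (hj : j < 2 ^ h)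
    (hjj : T j j = false) (hlt : ∀ a, T a j = true → a < 2 ^ h) (hg : IsGain T T' h i j F) :
    ∃ G₁ G₂ : Equiv.Perm ℕ, G₁ ≠ G₂ ∧
      (IsExchange T h i j F G₁ ∧ ∀ x, 2 ^ h ≤ x → G₁ x = x) ∧
      (IsExchange T h i j F G₂ ∧ ∀ x, 2 ^ h ≤ x → G₂ x = x) := by
  obtain ⟨hw, hwi, hwj⟩ := hg
  obtain ⟨t, p, q, hth, hm, hqp, hq, hk, hik⟩ :=
    exists_meetsAt hT hT' hagree hji hij hne hw hwi hwj
  have hp' := blockWinner_lt_imp hF hth.le (hm.1.trans_lt hi)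
  have hs' := blockWinner_lt_imp hF hth.le (hm.2.trans_lt hj)
  have hq' := blockWinner_lt_imp hF hth.le (hlt _ hk)
  have h1 := (swap_winner_left hm hq).1
  by_cases hu : ∀ r, T (blockWinner T F t r) j = true → r = q
  · refine ⟨(blockSwap t p q).trans F, (blockSwap t (sibling p) q).trans F, fun e => ?_,
      ⟨⟨t, p, q, hth, hm, hqp, hq, hk, Or.inl rfl⟩, blockSwap_trans_fixes hF hth.le hp' hq'⟩,
      ⟨⟨t, p, q, hth, hm, hqp, hq, hk, Or.inr ⟨hik, hu, rfl⟩⟩,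
        blockSwap_trans_fixes hF hth.le hs' hq'⟩⟩
    rw [e, (swap_winner_right hm hqp).1] at h1
    exact hne h1.symm
  · push Not at hu
    obtain ⟨r, hr, hrq⟩ := hu
    have hrp : r ≠ p := by
      rintro rfl
      rw [hm.1, hT _ _ hne, hji] at hr
      simp at hr
    have hrs : r ≠ sibling p := by
      rintro rfl
      rw [hm.2, hjj] at hr
      simp at hr
    refine ⟨(blockSwap t p q).trans F, (blockSwap t p r).trans F, fun e => ?_,
      ⟨⟨t, p, q, hth, hm, hqp, hq, hk, Or.inl rfl⟩, blockSwap_trans_fixes hF hth.le hp' hq'⟩,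
      ⟨⟨t, p, r, hth, hm, hrp, hrs, hr, Or.inl rfl⟩, blockSwap_trans_fixes hF hth.le hp'
        (blockWinner_lt_imp hF hth.le (hlt _ hr))⟩⟩
    rw [e] at h1
    exact hrq (blockWinner_injective _ _ _ ((swap_winner_left hm hrs).1.trans h1.symm))

end Range

section Fin

variable {n : ℕ}

/-- Extend a tournament to all natural numbers, every original player beating every new one. -/
def extendTournament (T : Tournament n) : ℕ → ℕ → Bool := fun a b =>
  if ha : a < n then if hb : b < n then T ⟨a, ha⟩ ⟨b, hb⟩ else true
  else if b < n then false else decide (a < b)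

theorem extendTournament_val (T : Tournament n) (a b : Fin n) :
    extendTournament T a b = T a b := by
  simp [extendTournament]

theorem extendTournament_antisymm {T : Tournament n} (hT : IsTournament T) (a b : ℕ)
    (hab : a ≠ b) : extendTournament T a b = !extendTournament T b a := by
  unfold extendTournament
  split_ifs with ha hb hb
  · exact hT.2 _ _ (by simpa using hab)
  · rfl
  · rfl
  · rw [← decide_not, decide_eq_decide]
    omega

theorem lt_of_extendTournament {T : Tournament n} {a b : ℕ} (hb : b < n)
    (h : extendTournament T a b = true) : a < n := by
  by_contra ha
  simp [extendTournament, ha, hb] at h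

theorem isTournament_flipTo {T : Tournament n} (hT : IsTournament T) {i j : Fin n}
    (hij : i ≠ j) : IsTournament (flipTo i j T) := by
  refine ⟨fun a => ?_, fun a b hab => ?_⟩
  · have h1 : ¬(a = i ∧ a = j) := fun h => hij (h.1.symm.trans h.2)
    have h2 : ¬(a = j ∧ a = i) := fun h => hij (h.2.symm.trans h.1)
    simp only [flipTo, h1, h2, if_false, hT.1 a]
  · have := hT.2 a b hab
    simp only [flipTo]
    split_ifs <;> simp_all

theorem extendTournament_flipTo {T : Tournament n} {i j : Fin n} (a b : ℕ)
    (h : ¬((a = (i : ℕ) ∧ b = (j : ℕ)) ∨ (a = (j : ℕ) ∧ b = (i : ℕ)))) :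
    extendTournament (flipTo i j T) a b = extendTournament T a b := by
  unfold extendTournament
  split_ifs with ha hb <;> try rfl
  push Not at h
  have h1 : ¬((⟨a, ha⟩ : Fin n) = i ∧ (⟨b, hb⟩ : Fin n) = j) := by
    simp only [Fin.ext_iff]
    tauto
  have h2 : ¬((⟨a, ha⟩ : Fin n) = j ∧ (⟨b, hb⟩ : Fin n) = i) := by
    simp only [Fin.ext_iff]
    tauto
  simp [flipTo, h1, h2]

theorem bWinner_eq_blockWinner (T : Tournament n) (s r : ℕ) (f : Fin (2 ^ s) → Fin n) (F : ℕ → ℕ)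
    (hF : ∀ x : Fin (2 ^ s), F (r * 2 ^ s + x) = f x) :
    (bWinner T s f : ℕ) = blockWinner (extendTournament T) F s r := by
  induction s generalizing r with
  | zero => simpa [bWinner, blockWinner] using (hF 0).symm
  | succ s ih =>
    have hl := ih (2 * r) (leftHalf s f) fun x => by
      rw [leftHalf, ← hF]
      congr 1
      simp only
      ring
    have hr := ih (2 * r + 1) (rightHalf s f) fun x => by
      rw [rightHalf, ← hF]
      congr 1
      simp only
      ring
    simp only [bWinner, blockWinner]
    rw [← hl, ← hr, extendTournament_val]
    split_ifs <;> rfl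

/-- Extend a permutation of the players to all natural numbers by the identity. -/
def natPerm (B : Equiv.Perm (Fin n)) : Equiv.Perm ℕ := B.extendDomain Fin.equivSubtype

theorem natPerm_val (B : Equiv.Perm (Fin n)) (x : Fin n) : natPerm B x = B x :=
  Equiv.Perm.extendDomain_apply_image B Fin.equivSubtype x

theorem natPerm_of_le (B : Equiv.Perm (Fin n)) (x : ℕ) (hx : n ≤ x) : natPerm B x = x :=
  Equiv.Perm.extendDomain_apply_not_subtype B Fin.equivSubtype (by omega)

theorem natPerm_injective : Function.Injective (natPerm (n := n)) := by
  intro B C h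
  ext x
  rw [← natPerm_val, h, natPerm_val]

theorem exists_natPerm_eq (F : Equiv.Perm ℕ) (hF : ∀ x, n ≤ x → F x = x) :
    ∃ B : Equiv.Perm (Fin n), natPerm B = F := by
  have hlt : ∀ x < n, F x < n := by
    intro x hx
    by_contra! hc
    have := F.injective (hF _ hc)
    omega
  have hinj : Function.Injective fun x : Fin n => (⟨F x, hlt x x.2⟩ : Fin n) := by
    intro x y hxy
    simpa [Fin.ext_iff] using hxy
  refine ⟨Equiv.ofBijective _ (Finite.injective_iff_bijective.mp hinj), ?_⟩
  ext x
  by_cases hx : x < n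
  · exact natPerm_val _ ⟨x, hx⟩
  · rw [natPerm_of_le _ _ (by omega), hF _ (by omega)]

theorem bWinner_eq_iff {h : ℕ} (T : Tournament (2 ^ h)) (B : Equiv.Perm (Fin (2 ^ h)))
    (i : Fin (2 ^ h)) :
    bWinner T h (fun x => B x) = i ↔ blockWinner (extendTournament T) (natPerm B) h 0 = i := by
  rw [Fin.ext_iff, bWinner_eq_blockWinner T h 0 _ (natPerm B) fun x => by
    rw [zero_mul, zero_add, natPerm_val]]

open Classical in
theorem card_gain_le {h : ℕ} {T : Tournament (2 ^ h)} (hT : IsTournament T)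
    {i j : Fin (2 ^ h)} (hij : i ≠ j) (hji : T j i = true) :
    3 * (Finset.univ.filter fun B : Equiv.Perm (Fin (2 ^ h)) =>
      IsGain (extendTournament T) (extendTournament (flipTo i j T)) h i j (natPerm B)).card ≤
      (2 ^ h).factorial := by
  set bad := Finset.univ.filter fun B : Equiv.Perm (Fin (2 ^ h)) =>
      IsGain (extendTournament T) (extendTournament (flipTo i j T)) h i j (natPerm B) with hbad
  have hA := extendTournament_antisymm hT
  have hA' := extendTournament_antisymm (isTournament_flipTo hT hij)
  have hagree := extendTournament_flipTo (T := T) (i := i) (j := j)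
  have hji' : extendTournament T j i = true := by rw [extendTournament_val, hji]
  have hij' : extendTournament (flipTo i j T) i j = true := by
    simp [extendTournament_val, flipTo]
  have hne : (i : ℕ) ≠ j := by simpa [Fin.ext_iff] using hij
  have hcount := Finset.card_mul_le_card_mul (s := bad) (t := badᶜ) (m := 2) (n := 1)
    (fun B G => IsExchange (extendTournament T) h i j (natPerm B) (natPerm G)) (by
      intro B hB
      obtain ⟨G₁, G₂, hG, ⟨h1, hf1⟩, h2, hf2⟩ := exists_two_isExchange hA hA' hagree hji' hij' hne
        (natPerm_of_le B) i.2 j.2 (by rw [extendTournament_val, hT.1])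
        (fun a ha => lt_of_extendTournament j.2 ha) (Finset.mem_filter.mp hB).2
      obtain ⟨C₁, rfl⟩ := exists_natPerm_eq G₁ hf1
      obtain ⟨C₂, rfl⟩ := exists_natPerm_eq G₂ hf2
      refine Finset.one_lt_card.mpr ⟨C₁, ?_, C₂, ?_, fun e => hG (by rw [e])⟩
      · simpa [Finset.bipartiteAbove, hbad, h1] using
          not_isGain_of_isExchange hA hA' hagree hji' hij' hne hf1 j.2 h1
      · simpa [Finset.bipartiteAbove, hbad, h2] using
          not_isGain_of_isExchange hA hA' hagree hji' hij' hne hf2 j.2 h2) (by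
      intro G _
      refine Finset.card_le_one.mpr fun B hB C hC => natPerm_injective ?_
      exact isExchange_left_unique hA (Finset.mem_filter.mp hB).2 (Finset.mem_filter.mp hC).2)
  have htotal := Finset.card_add_card_compl bad
  rw [Fintype.card_perm, Fintype.card_fin] at htotal
  omega

end Fin

/-- The random single-elimination bracket rule is 2-SNM-1/3: the probability the
winner is in {i,j} increases by at most 1/3 when j throws the match to i. -/
theorem stmt_17 (h : ℕ) (T : Tournament (2^h)) (hT : IsTournament T)
    (i j : Fin (2^h)) (hij : i ≠ j) (hji : T j i = true) :
    (rseb h (flipTo i j T) i + rseb h (flipTo i j T) j) -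
      (rseb h T i + rseb h T j) ≤ 1/3 := by
  classical
  have hgain := card_gain_le hT hij hji
  set bad := Finset.univ.filter fun B : Equiv.Perm (Fin (2 ^ h)) =>
    IsGain (extendTournament T) (extendTournament (flipTo i j T)) h i j (natPerm B) with hbad
  set W : Tournament (2 ^ h) → Fin (2 ^ h) → ℕ := fun T i =>
    (Finset.univ.filter fun B : Equiv.Perm (Fin (2 ^ h)) =>
      bWinner T h (fun x => B x) = i).card with hW
  have hle : W (flipTo i j T) i + W (flipTo i j T) j ≤ W T i + W T j + bad.card := by
    simp only [hW, hbad, Finset.card_filter, ← Finset.sum_add_distrib]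
    refine Finset.sum_le_sum fun B _ => ?_
    simp only [IsGain, ← bWinner_eq_iff, ne_eq]
    by_cases h1 : bWinner (flipTo i j T) h (fun x => B x) = i
    · have h2 : bWinner (flipTo i j T) h (fun x => B x) ≠ j := fun e => hij (h1.symm.trans e)
      split_ifs <;> simp_all
    · split_ifs <;> simp_all
  have hpos : (0 : ℝ) < (2 ^ h).factorial := by exact_mod_cast Nat.factorial_pos _
  change ((W (flipTo i j T) i : ℝ) / (2 ^ h).factorial + (W (flipTo i j T) j : ℝ) /
    (2 ^ h).factorial) - ((W T i : ℝ) / (2 ^ h).factorial + (W T j : ℝ) / (2 ^ h).factorial) ≤ 1 / 3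
  rw [← add_div, ← add_div, ← sub_div, div_le_iff₀ hpos]
  have hle' : (W (flipTo i j T) i + W (flipTo i j T) j : ℝ) ≤ W T i + W T j + bad.card := by
    exact_mod_cast hle
  have hgain' : 3 * (bad.card : ℝ) ≤ (2 ^ h).factorial := by exact_mod_cast hgain
  linarith
end
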